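/- Let (X, dist) be a pseudometric space and α > 0 a real number. Then for all points w₁, w₂, v in X, it holds that |1/(dist w₁ v + α) − 1/(dist w₂ v + α)| ≤ (dist w₁ w₂)/(α·(dist w₁ w₂ + α)). -/

import Mathlib

theorem sens_aux (α a b c : ℝ) (hα : 0 < α) (ha : 0 ≤ a) (hb : 0 ≤ b) (hc : 0 ≤ c)
    (h : b ≤ a + c) : 1 / (a + α) - 1 / (b + α) ≤ c / (α * (c + α)) := by
  have h1 : 1 / (a + c + α) ≤ 1 / (b + α) :=
    one_div_le_one_div_of_le (by linarith) (by linarith)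
  have h2 : 1 / (a + α) - 1 / (a + c + α) = c / ((a + α) * (a + c + α)) := by
    have : a + α ≠ 0 := by positivity
    have : a + c + α ≠ 0 := by positivity
    field_simp
    ring
  have h3 : c / ((a + α) * (a + c + α)) ≤ c / (α * (c + α)) := by
    apply div_le_div_of_nonneg_left hc (by positivity)
    apply mul_le_mul <;> first | linarith | positivity
  linarith

theorem sensitivity_bound_instancewise
    {X : Type*} [PseudoMetricSpace X]
    (α : ℝ) (hα : 0 < α) (w₁ w₂ v : X) :
    |1 / (dist w₁ v + α) - 1 / (dist w₂ v + α)|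
      ≤ dist w₁ w₂ / (α * (dist w₁ w₂ + α)) := by
  have t1 := dist_triangle w₁ w₂ v
  have t2 := dist_triangle w₂ w₁ v
  rw [dist_comm w₂ w₁] at t2
  rw [abs_sub_le_iff]
  exact ⟨sens_aux α _ _ _ hα dist_nonneg dist_nonneg dist_nonneg (by linarith),
    sens_aux α _ _ _ hα dist_nonneg dist_nonneg dist_nonneg (by linarith)⟩
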